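/- For every natural number n, the number of pairs (λ, μ), where λ is a partition into odd parts with every part size occurring at most three times, μ is a partition with every part size occurring at most three times, and |λ| + |μ| = 2n, equals the number of quadruples (λ₁, λ₂, μ₁, μ₂), where λ₁ and λ₂ are partitions into odd parts with every part size occurring at most three times, μ₁ and μ₂ are partitions with every part size occurring at most three times, and |λ₁| + |λ₂| + |μ₁| + |μ₂| = n. -/

import Mathlib

/-- A partition into odd parts with every part size occurring at most three times. -/
def OddPartitionMultAtMostThree (lam : Multiset ℕ) : Prop :=
  (∀ i ∈ lam, Odd i) ∧ (∀ i, lam.count i ≤ 3)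

/-- A partition (into positive parts) with every part size occurring at most three times. -/
def PartitionMultAtMostThree (mu : Multiset ℕ) : Prop :=
  (∀ i ∈ mu, 0 < i) ∧ (∀ i, mu.count i ≤ 3)

open PowerSeries Finset Filter Topology
open scoped PowerSeries.WithPiTopology

section QBinomial

variable {R : Type*} [CommRing R]

/-- The Gaussian binomial coefficient evaluated at `q`. -/
def qBinomial (q : R) : ℕ → ℕ → R
  | _, 0 => 1
  | 0, _ + 1 => 0
  | n + 1, k + 1 => qBinomial q n k + q ^ (k + 1) * qBinomial q n (k + 1)

theorem qBinomial_zero_right (q : R) (n : ℕ) : qBinomial q n 0 = 1 := by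
  cases n <;> rfl

theorem qBinomial_succ_succ (q : R) (n k : ℕ) :
    qBinomial q (n + 1) (k + 1) = qBinomial q n k + q ^ (k + 1) * qBinomial q n (k + 1) := rfl

theorem qBinomial_eq_zero_of_lt (q : R) {n k : ℕ} (h : n < k) : qBinomial q n k = 0 := by
  induction n generalizing k with
  | zero => obtain ⟨k, rfl⟩ := Nat.exists_eq_succ_of_ne_zero h.ne'; rfl
  | succ n ih =>
    obtain ⟨k, rfl⟩ := Nat.exists_eq_succ_of_ne_zero (Nat.ne_zero_of_lt h)
    rw [Nat.succ_eq_add_one, qBinomial_succ_succ, ih (by omega), ih (by omega)]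
    ring

theorem qBinomial_self (q : R) (n : ℕ) : qBinomial q n n = 1 := by
  induction n with
  | zero => rfl
  | succ n ih => rw [qBinomial_succ_succ, ih, qBinomial_eq_zero_of_lt q n.lt_succ_self]; ring

theorem qBinomial_add_mul_prod (q : R) (m n : ℕ) :
    qBinomial q (m + n) n *
      ((∏ i ∈ range m, (1 - q ^ (i + 1))) * ∏ i ∈ range n, (1 - q ^ (i + 1))) =
      ∏ i ∈ range (m + n), (1 - q ^ (i + 1)) := by
  induction n generalizing m with
  | zero => simp [qBinomial_zero_right]
  | succ n ihn =>
    induction m with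
    | zero => simp [qBinomial_self]
    | succ m ihm =>
      have h := ihn (m + 1)
      have e : m + 1 + (n + 1) = m + n + 1 + 1 := by ring
      rw [e, qBinomial_succ_succ]
      rw [show m + (n + 1) = m + n + 1 by ring] at ihm
      rw [show m + 1 + n = m + n + 1 by ring] at h
      rw [prod_range_succ _ (m + n + 1)]
      rw [prod_range_succ _ n] at ihm ⊢
      rw [prod_range_succ _ m] at h ⊢
      linear_combination (1 - q ^ (n + 1)) * h + q ^ (n + 1) * (1 - q ^ (m + 1)) * ihm

/-- The `q`-binomial theorem. -/
theorem prod_add_mul_pow_eq_sum_qBinomial (q x y : R) (n : ℕ) :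
    ∏ i ∈ range n, (y + x * q ^ i) =
      ∑ j ∈ range (n + 1), q ^ j.choose 2 * qBinomial q n j * x ^ j * y ^ (n - j) := by
  induction n generalizing x with
  | zero => simp [qBinomial_zero_right]
  | succ n ih =>
    have h : ∏ i ∈ range n, (y + x * q ^ (i + 1)) = ∏ i ∈ range n, (y + x * q * q ^ i) :=
      prod_congr rfl fun i _ => by ring
    rw [prod_range_succ', h, ih, sum_range_succ' _ (n + 1), pow_zero, mul_one, mul_add, sum_mul,
      sum_mul, sum_range_succ' (fun j => _ * y)]
    have hx : ∀ j ∈ range (n + 1), q ^ (j + 1).choose 2 * qBinomial q (n + 1) (j + 1) *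
        x ^ (j + 1) * y ^ (n + 1 - (j + 1)) =
        q ^ (j + 1).choose 2 * q ^ (j + 1) * qBinomial q n (j + 1) * x ^ (j + 1) * y ^ (n - j) +
        q ^ j.choose 2 * qBinomial q n j * (x * q) ^ j * y ^ (n - j) * x := by
      intro j _
      rw [qBinomial_succ_succ, Nat.choose_succ_succ' j 1, Nat.choose_one_right,
        Nat.add_sub_add_right]
      ring
    rw [sum_congr rfl hx, sum_add_distrib, sum_range_succ (fun j => q ^ (j + 1).choose 2 * _ * _ *
      _ * _) n, qBinomial_eq_zero_of_lt q n.lt_succ_self]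
    have hy : ∀ j ∈ range n, q ^ (j + 1).choose 2 * qBinomial q n (j + 1) * (x * q) ^ (j + 1) *
        y ^ (n - (j + 1)) * y = q ^ (j + 1).choose 2 * q ^ (j + 1) * qBinomial q n (j + 1) *
        x ^ (j + 1) * y ^ (n - j) := by
      intro j hj
      rw [show n - j = n - (j + 1) + 1 by grind]
      ring
    rw [sum_congr rfl hy]
    simp [qBinomial_zero_right]
    ring

end QBinomial

/-- A finite form of the Jacobi triple product identity at `z = 1`. -/
theorem prod_one_add_X_pow_odd_sq (m : ℕ) :
    (∏ i ∈ range (m + 1), (1 + X ^ (2 * i + 1) : ℤ⟦X⟧)) ^ 2 =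
      ∑ j ∈ range (2 * (m + 1) + 1),
        qBinomial (X ^ 2) (2 * (m + 1)) j * X ^ ((j - (m + 1) : ℤ).natAbs ^ 2) := by
  have h := prod_add_mul_pow_eq_sum_qBinomial (X ^ 2 : ℤ⟦X⟧) 1 (X ^ (2 * m + 1)) (2 * (m + 1))
  have h1 : ∏ i ∈ range (m + 1), (X ^ (2 * m + 1) + 1 * (X ^ 2) ^ i : ℤ⟦X⟧) =
      X ^ ((m + 1) * m) * ∏ i ∈ range (m + 1), (1 + X ^ (2 * i + 1)) := by
    rw [← prod_range_reflect (fun i => (1 + X ^ (2 * i + 1) : ℤ⟦X⟧)),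
      show (m + 1) * m = ∑ i ∈ range (m + 1), 2 * i by
        rw [← mul_sum, mul_comm 2, sum_range_id_mul_two, Nat.add_sub_cancel],
      ← prod_pow_eq_pow_sum, ← prod_mul_distrib]
    refine prod_congr rfl fun i hi => ?_
    rw [mul_add, ← pow_add, show 2 * i + (2 * (m + 1 - 1 - i) + 1) = 2 * m + 1 by grind]
    ring
  have h2 : ∏ i ∈ range (m + 1), (X ^ (2 * m + 1) + 1 * (X ^ 2) ^ (m + 1 + i) : ℤ⟦X⟧) =
      X ^ ((m + 1) * (2 * m + 1)) * ∏ i ∈ range (m + 1), (1 + X ^ (2 * i + 1)) := by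
    rw [show (X ^ ((m + 1) * (2 * m + 1)) : ℤ⟦X⟧) = ∏ _i ∈ range (m + 1), X ^ (2 * m + 1) by
      simp [← pow_mul, mul_comm], ← prod_mul_distrib]
    exact prod_congr rfl fun i hi => by ring
  rw [two_mul (m + 1), prod_range_add, h1, h2, ← two_mul] at h
  refine mul_left_cancel₀ (pow_ne_zero ((m + 1) * (3 * m + 1)) X_ne_zero) ?_
  rw [mul_sum]
  calc _ = _ := by ring
    _ = _ := h
    _ = _ := sum_congr rfl fun j hj => ?_
  rw [← pow_mul, ← pow_mul]
  have hexp : 2 * j.choose 2 + (2 * m + 1) * (2 * (m + 1) - j) =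
      (m + 1) * (3 * m + 1) + (j - (m + 1) : ℤ).natAbs ^ 2 := by
    have hc : 2 * j.choose 2 + j = j * j := by
      rw [mul_comm, Nat.choose_two_right, Nat.div_mul_cancel (Nat.even_mul_pred_self j).two_dvd]
      cases j <;> simp; ring
    have hj' : j ≤ 2 * (m + 1) := by grind
    zify [hj']
    zify at hc
    rw [sq_abs]
    linear_combination hc
  linear_combination qBinomial (X ^ 2 : ℤ⟦X⟧) (2 * (m + 1)) j * congrArg (X ^ · : ℕ → ℤ⟦X⟧) hexp

theorem X_pow_dvd_tprod_sub_prod_range {f : ℕ → ℤ⟦X⟧} (hf : Multipliable f) {n p : ℕ}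
    (h : ∀ i, n ≤ i → X ^ p ∣ f i - 1) : X ^ p ∣ (∏' i, f i) - ∏ i ∈ range n, f i := by
  have hk (k : ℕ) : X ^ p ∣ (∏ i ∈ range (n + k), f i) - ∏ i ∈ range n, f i := by
    induction k with
    | zero => simp
    | succ k ih =>
      have := (ih.add ((h (n + k) (by omega)).mul_left (∏ i ∈ range (n + k), f i)))
      rw [← add_assoc, prod_range_succ]
      convert! this using 1
      ring
  rw [X_pow_dvd_iff]
  intro d hd
  rw [map_sub, sub_eq_zero]
  have ht := (((WithPiTopology.continuous_coeff ℤ d).tendsto _).comp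
    hf.hasProd.tendsto_prod_nat)
  refine tendsto_nhds_unique ht (tendsto_atTop_of_eventually_const (i₀ := n) fun N hN => ?_)
  obtain ⟨k, rfl⟩ := Nat.exists_eq_add_of_le hN
  have := X_pow_dvd_iff.mp (hk k) d hd
  rwa [map_sub, sub_eq_zero] at this

theorem multipliable_one_add_mul_X_pow (c : ℤ⟦X⟧) {u : ℕ → ℕ} (hu : ∀ i, i ≤ u i) :
    Multipliable fun i => 1 + c * X ^ u i := by
  refine WithPiTopology.multipliable_one_add_of_tendsto_order_atTop_nhds_top ℤ ?_
  refine ENat.tendsto_nhds_top_iff_natCast_lt.mpr fun n =>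
    eventually_atTop.mpr ⟨n + 1, fun i hi => ?_⟩
  grw [← le_order_mul, order_X_pow]
  refine lt_add_of_nonneg_of_lt (by simp) ?_
  have := hu i
  norm_cast
  omega

theorem multipliable_one_add_X_pow {u : ℕ → ℕ} (hu : ∀ i, i ≤ u i) :
    Multipliable fun i => (1 + X ^ u i : ℤ⟦X⟧) := by
  simpa using multipliable_one_add_mul_X_pow 1 hu

theorem continuous_expand (p : ℕ) (hp : p ≠ 0) : Continuous (expand p hp : ℤ⟦X⟧ → ℤ⟦X⟧) := by
  refine continuous_iff_continuousAt.mpr fun f => ?_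
  rw [ContinuousAt, WithPiTopology.tendsto_iff_coeff_tendsto]
  intro d
  simp_rw [coeff_expand]
  split_ifs
  · exact (WithPiTopology.continuous_coeff ℤ _).tendsto f
  · exact tendsto_const_nhds

/-- The product of `1 + X ^ k` over odd `k`. -/
noncomputable def oddProd : ℤ⟦X⟧ := ∏' i : ℕ, (1 + X ^ (2 * i + 1))

/-- The product of `1 + X ^ k` over positive `k`. -/
noncomputable def posProd : ℤ⟦X⟧ := ∏' i : ℕ, (1 + X ^ (i + 1))

/-- The product of `1 - X ^ k` over positive `k`. -/
noncomputable def eulerProd : ℤ⟦X⟧ := ∏' i : ℕ, (1 - X ^ (i + 1))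

theorem expand_two_posProd :
    expand 2 two_ne_zero posProd = ∏' i : ℕ, (1 + X ^ (2 * (i + 1)) : ℤ⟦X⟧) := by
  rw [posProd, (multipliable_one_add_X_pow fun i => by omega).map_tprod _ (continuous_expand 2 _)]
  simp [pow_mul]

theorem expand_two_oddProd :
    expand 2 two_ne_zero oddProd = ∏' i : ℕ, (1 + X ^ (2 * (2 * i + 1)) : ℤ⟦X⟧) := by
  rw [oddProd, (multipliable_one_add_X_pow fun i => by omega).map_tprod _ (continuous_expand 2 _)]
  simp [pow_mul]

theorem expand_two_eulerProd :
    expand 2 two_ne_zero eulerProd = ∏' i : ℕ, (1 - (X ^ 2) ^ (i + 1) : ℤ⟦X⟧) := by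
  rw [eulerProd, (WithPiTopology.multipliable_one_sub_X_pow ℤ).map_tprod _
    (continuous_expand 2 _)]
  simp

theorem posProd_eq : posProd = oddProd * expand 2 two_ne_zero posProd := by
  rw [expand_two_posProd, posProd, oddProd]
  exact (tprod_even_mul_odd (f := fun i => (1 + X ^ (i + 1) : ℤ⟦X⟧))
    (multipliable_one_add_X_pow fun i => by omega)
    (multipliable_one_add_X_pow (u := fun i => 2 * i + 1 + 1) fun i => by omega)).symm

theorem expand_two_eulerProd_eq : expand 2 two_ne_zero eulerProd = eulerProd * posProd := by
  rw [expand_two_eulerProd, posProd, eulerProd,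
    ← (WithPiTopology.multipliable_one_sub_X_pow ℤ).tprod_mul
      (multipliable_one_add_X_pow fun i => by omega)]
  exact tprod_congr fun i => by ring

theorem multipliable_one_sub_X_sq_pow :
    Multipliable fun i : ℕ => (1 - (X ^ 2) ^ (i + 1) : ℤ⟦X⟧) := by
  convert! multipliable_one_add_mul_X_pow (-1) (u := fun i => 2 * (i + 1)) fun i => by omega using 2
  ring

theorem constantCoeff_eulerProd : constantCoeff eulerProd = 1 := by
  simp [eulerProd, (WithPiTopology.multipliable_one_sub_X_pow ℤ).map_tprod _
    (WithPiTopology.continuous_constantCoeff ℤ)]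

theorem isUnit_expand_two_eulerProd : IsUnit (expand 2 two_ne_zero eulerProd) := by
  simp [isUnit_iff_constantCoeff, constantCoeff_eulerProd]

theorem X_pow_dvd_expand_two_eulerProd_sub_prod (n : ℕ) :
    X ^ (2 * (n + 1)) ∣
      expand 2 two_ne_zero eulerProd - ∏ i ∈ range n, (1 - (X ^ 2) ^ (i + 1) : ℤ⟦X⟧) := by
  rw [expand_two_eulerProd]
  refine X_pow_dvd_tprod_sub_prod_range multipliable_one_sub_X_sq_pow fun i hi => ?_
  rw [← pow_mul, sub_sub_cancel_left, dvd_neg]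
  exact pow_dvd_pow _ (by omega)

theorem X_pow_dvd_qBinomial_mul_eulerProd_sub_one (m n : ℕ) {p : ℕ} (hm : p ≤ 2 * (m + 1))
    (hn : p ≤ 2 * (n + 1)) :
    X ^ p ∣ qBinomial (X ^ 2) (m + n) n * expand 2 two_ne_zero eulerProd - 1 := by
  have key := qBinomial_add_mul_prod (X ^ 2 : ℤ⟦X⟧) m n
  have dm := (pow_dvd_pow _ hm).trans (X_pow_dvd_expand_two_eulerProd_sub_prod m)
  have dn := (pow_dvd_pow _ hn).trans (X_pow_dvd_expand_two_eulerProd_sub_prod n)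
  have dmn := (pow_dvd_pow _ (by omega : p ≤ 2 * (m + n + 1))).trans
    (X_pow_dvd_expand_two_eulerProd_sub_prod (m + n))
  set E : ℤ⟦X⟧ := expand 2 two_ne_zero eulerProd
  rw [← isUnit_expand_two_eulerProd.dvd_mul_left]
  convert! ((dm.mul_left (qBinomial (X ^ 2) (m + n) n * E)).add
    (dn.mul_left (qBinomial (X ^ 2) (m + n) n *
      ∏ i ∈ range m, (1 - (X ^ 2) ^ (i + 1) : ℤ⟦X⟧)))).sub dmn using 1
  linear_combination key

theorem coeff_oddProd_sq_mul (n m : ℕ) (h : n ≤ m) :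
    coeff (R := ℤ) n (oddProd ^ 2 * expand 2 two_ne_zero eulerProd) =
      #{k ∈ Icc (-(m + 1) : ℤ) (m + 1) | k.natAbs ^ 2 = n} := by
  have hA : X ^ (2 * m + 3) ∣ oddProd - ∏ i ∈ range (m + 1), (1 + X ^ (2 * i + 1) : ℤ⟦X⟧) := by
    refine X_pow_dvd_tprod_sub_prod_range (multipliable_one_add_X_pow fun i => by omega)
      fun i hi => ?_
    rw [add_sub_cancel_left]
    exact pow_dvd_pow _ (by omega)
  set E : ℤ⟦X⟧ := expand 2 two_ne_zero eulerProd with hE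
  have hsum : X ^ (2 * m + 3) ∣
      (∏ i ∈ range (m + 1), (1 + X ^ (2 * i + 1) : ℤ⟦X⟧)) ^ 2 * E -
        ∑ j ∈ range (2 * (m + 1) + 1), X ^ ((j - (m + 1) : ℤ).natAbs ^ 2) := by
    rw [prod_one_add_X_pow_odd_sq, sum_mul, ← sum_sub_distrib]
    refine dvd_sum fun j hj => ?_
    have hj' : j ≤ 2 * (m + 1) := by grind
    obtain ⟨l, hl⟩ := Nat.exists_eq_add_of_le' hj'
    set d := (j - (m + 1) : ℤ).natAbs with hd
    have h1 := X_pow_dvd_qBinomial_mul_eulerProd_sub_one l j (p := 2 * (m + 2 - d))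
      (by omega) (by omega)
    have h2 := mul_dvd_mul h1 (dvd_refl (X ^ (d ^ 2) : ℤ⟦X⟧))
    rw [← pow_add, ← hE, ← hl] at h2
    have hexp : 2 * m + 3 ≤ 2 * (m + 2 - d) + d ^ 2 := by
      have hdm : d ≤ m + 2 := by omega
      zify [hdm]
      nlinarith [sq_nonneg ((d : ℤ) - 1)]
    convert! (pow_dvd_pow _ hexp).trans h2 using 1
    ring
  have hd := (hA.mul_left
    ((oddProd + ∏ i ∈ range (m + 1), (1 + X ^ (2 * i + 1) : ℤ⟦X⟧)) * E)).add hsum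
  have hc := X_pow_dvd_iff.mp hd n (by omega)
  rw [show ∀ a b c d : ℤ⟦X⟧, (a + b) * c * (a - b) + (b ^ 2 * c - d) = a ^ 2 * c - d by
    intros; ring, map_sub, sub_eq_zero] at hc
  rw [hc, map_sum, card_filter, Nat.cast_sum]
  refine sum_bij' (fun j _ => (j - (m + 1) : ℤ)) (fun k _ => (k + (m + 1)).toNat) ?_ ?_ ?_ ?_ ?_
  · intro j hj; grind
  · intro k hk; grind
  · intro j hj; grind
  · intro k hk; grind
  · intro j hj
    simp [coeff_X_pow, eq_comm]

theorem coeff_oddProd_sq_mul_eq_expand_four {n : ℕ} (hn : Even n) :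
    coeff (R := ℤ) n (oddProd ^ 2 * expand 2 two_ne_zero eulerProd) =
      coeff n (expand 4 four_ne_zero (oddProd ^ 2 * expand 2 two_ne_zero eulerProd)) := by
  rw [coeff_oddProd_sq_mul n n le_rfl, coeff_expand]
  split_ifs with h
  · obtain ⟨l, rfl⟩ := h
    rw [Nat.mul_div_cancel_left _ (by norm_num), coeff_oddProd_sq_mul l (4 * l) (by omega)]
    norm_cast
    symm
    refine card_bij (fun k _ => 2 * k) ?_ ?_ ?_
    · intro k hk
      simp only [mem_filter, mem_Icc] at hk ⊢
      have hk2 : (2 * k).natAbs ^ 2 = 4 * l := by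
        rw [Int.natAbs_mul, mul_pow, hk.2]; rfl
      have := Nat.le_self_pow two_ne_zero (2 * k).natAbs
      exact ⟨by omega, hk2⟩
    · intro a _ b _ hab; omega
    · intro k hk
      simp only [mem_filter, mem_Icc] at hk
      have he : Even k := by
        rw [← Int.natAbs_even, ← Nat.even_pow' two_ne_zero, hk.2]; exact hn
      obtain ⟨j, rfl⟩ := he
      have hj : 4 * j.natAbs ^ 2 = 4 * l := by
        rw [← hk.2, ← two_mul, Int.natAbs_mul, mul_pow]; rfl
      refine ⟨j, ?_, by ring⟩
      simp only [mem_filter, mem_Icc]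
      omega
  · rw [Nat.cast_eq_zero, card_eq_zero, filter_eq_empty_iff]
    intro k _ hk
    apply h
    have he : Even k.natAbs := by
      rw [← Nat.even_pow' two_ne_zero, hk]; exact hn
    rw [← hk]
    exact pow_dvd_pow_of_dvd he.two_dvd 2

theorem coeff_two_mul_eq_coeff_sq (n : ℕ) :
    coeff (2 * n) (oddProd * expand 2 two_ne_zero oddProd *
      (posProd * expand 2 two_ne_zero posProd)) =
    coeff n ((oddProd * expand 2 two_ne_zero oddProd *
      (posProd * expand 2 two_ne_zero posProd)) ^ 2) := by
  set F := oddProd * expand 2 two_ne_zero oddProd * (posProd * expand 2 two_ne_zero posProd)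
    with hF
  set φ := oddProd ^ 2 * expand 2 two_ne_zero eulerProd with hφ
  have hσ (f : ℤ⟦X⟧) :
      evalNegHom (expand 2 two_ne_zero f) = expand 2 two_ne_zero f := by
    ext d
    rw [evalNegHom, coeff_rescale, coeff_expand]
    split_ifs with h
    · rw [(even_iff_two_dvd.mpr h).neg_one_pow, one_mul]
    · simp
  have hodd : evalNegHom (φ - expand 4 four_ne_zero φ) = -(φ - expand 4 four_ne_zero φ) := by
    ext d
    rw [evalNegHom, coeff_rescale, map_neg]
    rcases Nat.even_or_odd d with h | h
    · rw [map_sub, coeff_oddProd_sq_mul_eq_expand_four h, sub_self]; simp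
    · rw [h.neg_one_pow]; ring
  have h4 (f : ℤ⟦X⟧) : expand 4 four_ne_zero f =
      expand 2 two_ne_zero (expand 2 two_ne_zero f) := expand_mul 2 two_ne_zero 2 two_ne_zero f
  have hp := posProd_eq
  have hp2 := congrArg (expand 2 two_ne_zero) hp
  have he := expand_two_eulerProd_eq
  have he2 := congrArg (expand 2 two_ne_zero) he
  have he4 := congrArg (expand 2 two_ne_zero) he2
  have key : expand 2 two_ne_zero eulerProd * (F - expand 2 two_ne_zero (F ^ 2)) =
      (φ - expand 4 four_ne_zero φ) * expand 2 two_ne_zero (oddProd * posProd ^ 2) := by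
    simp only [h4, hF, hφ, map_mul, map_pow] at hp2 he2 he4 ⊢
    rw [he4, he2]
    clear he he2 he4
    generalize expand 2 two_ne_zero (expand 2 two_ne_zero posProd) = b₄ at *
    generalize expand 2 two_ne_zero posProd = b₂ at *
    rw [hp, hp2]
    ring
  have hanti : evalNegHom (F - expand 2 two_ne_zero (F ^ 2)) =
      -(F - expand 2 two_ne_zero (F ^ 2)) := by
    have h := congrArg evalNegHom key
    rw [map_mul, map_mul, hσ, hσ, hodd] at h
    refine isUnit_expand_two_eulerProd.mul_left_cancel ?_
    linear_combination h + key
  have hc := congrArg (coeff (2 * n)) hanti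
  rw [evalNegHom, coeff_rescale, (even_two_mul n).neg_one_pow, map_neg, map_sub,
    coeff_expand_mul] at hc
  linarith

section WeightSeries

variable {α β : Type*}

/-- The generating function counting the elements of `α` by weight. -/
noncomputable def weightSeries (w : α → ℕ) : ℤ⟦X⟧ := mk fun n => (Nat.card {x // w x = n} : ℤ)

/-- A pair of total weight `n` is a pair of elements whose weights form an antidiagonal pair. -/
def prodWeightEquiv (w : α → ℕ) (v : β → ℕ) (n : ℕ) : {p : α × β // w p.1 + v p.2 = n} ≃
    (k : antidiagonal n) × ({x // w x = k.1.1} × {x // v x = k.1.2}) where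
  toFun p := ⟨⟨(w p.1.1, v p.1.2), mem_antidiagonal.mpr p.2⟩, ⟨p.1.1, rfl⟩, ⟨p.1.2, rfl⟩⟩
  invFun p := ⟨(p.2.1.1, p.2.2.1), by
    rw [p.2.1.2, p.2.2.2]; exact mem_antidiagonal.mp p.1.2⟩
  left_inv _ := rfl
  right_inv := by
    rintro ⟨⟨⟨i, j⟩, h⟩, ⟨a, ha⟩, ⟨b, hb⟩⟩
    dsimp only at ha hb
    subst ha hb
    rfl

theorem finite_prod_weight_fiber {w : α → ℕ} {v : β → ℕ} (hw : ∀ n, Finite {x // w x = n})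
    (hv : ∀ n, Finite {x // v x = n}) (n : ℕ) :
    Finite {p : α × β // w p.1 + v p.2 = n} :=
  Finite.of_equiv _ (prodWeightEquiv w v n).symm

theorem weightSeries_prod {w : α → ℕ} {v : β → ℕ} (hw : ∀ n, Finite {x // w x = n})
    (hv : ∀ n, Finite {x // v x = n}) :
    weightSeries (fun p : α × β => w p.1 + v p.2) = weightSeries w * weightSeries v := by
  ext n
  simp only [weightSeries, coeff_mul, coeff_mk]
  rw [Nat.card_congr (prodWeightEquiv w v n), Nat.card_sigma,
    sum_coe_sort (antidiagonal n) fun k => Nat.card ({x // w x = k.1} × {x // v x = k.2})]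
  simp [Nat.card_prod]

end WeightSeries

/-- Multisets of positive integers satisfying `P`, each occurring at most three times. -/
abbrev ThreeRestricted (P : ℕ → Prop) : Type :=
  {m : Multiset ℕ // (∀ i ∈ m, 0 < i ∧ P i) ∧ ∀ i, m.count i ≤ 3}

section ThreeRestricted

variable (P : ℕ → Prop)

/-- Multisets in `ThreeRestricted P` of sum `n` as partitions of `n`. -/
def threeRestrictedEquiv (n : ℕ) : {m : ThreeRestricted P // m.1.sum = n} ≃
    {p : n.Partition // ∀ i ∈ p.parts, P i ∧ p.parts.count i ≤ 3} where
  toFun m := ⟨⟨m.1.1, fun hi => (m.1.2.1 _ hi).1, m.2⟩,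
    fun i hi => ⟨(m.1.2.1 i hi).2, m.1.2.2 i⟩⟩
  invFun p := ⟨⟨p.1.parts, fun i hi => ⟨p.1.parts_pos hi, (p.2 i hi).1⟩, fun i => by
    by_cases hi : i ∈ p.1.parts
    · exact (p.2 i hi).2
    · simp [Multiset.count_eq_zero_of_notMem hi]⟩, p.1.parts_sum⟩
  left_inv _ := rfl
  right_inv _ := rfl

theorem finite_threeRestricted_fiber (n : ℕ) : Finite {m : ThreeRestricted P // m.1.sum = n} :=
  Finite.of_equiv _ (threeRestrictedEquiv P n).symm

theorem weightSeries_threeRestricted [DecidablePred P] :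
    weightSeries (fun m : ThreeRestricted P => m.1.sum) =
      ∏' i : ℕ, if P (i + 1) then (1 + X ^ (i + 1)) * (1 + X ^ (2 * (i + 1))) else 1 := by
  have h : weightSeries (fun m : ThreeRestricted P => m.1.sum) =
      Nat.Partition.genFun fun i c => if P i ∧ c ≤ 3 then 1 else 0 := by
    ext n
    rw [weightSeries, coeff_mk, Nat.Partition.coeff_genFun,
      Nat.card_congr (threeRestrictedEquiv P n), Nat.card_eq_fintype_card, Fintype.card_subtype,
      card_filter, Nat.cast_sum]
    refine sum_congr rfl fun p _ => ?_
    rw [Finsupp.prod, prod_ite_zero]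
    simp
  rw [h, Nat.Partition.genFun_eq_tprod]
  refine tprod_congr fun i => ?_
  simp_rw [smul_eq_C_mul]
  rw [tsum_eq_sum (s := range 3) fun j hj => by
    rw [if_neg (by grind), map_zero, zero_mul]]
  split_ifs with hP
  · simp [hP, sum_range_succ]
    ring
  · simp [hP]

end ThreeRestricted

theorem weightSeries_threeRestricted_true :
    weightSeries (fun m : ThreeRestricted fun _ => True => m.1.sum) =
      posProd * expand 2 two_ne_zero posProd := by
  rw [weightSeries_threeRestricted, expand_two_posProd, posProd,
    ← (multipliable_one_add_X_pow fun i => by omega).tprod_mul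
      (multipliable_one_add_X_pow fun i => by omega)]
  simp

theorem weightSeries_threeRestricted_odd :
    weightSeries (fun m : ThreeRestricted Odd => m.1.sum) =
      oddProd * expand 2 two_ne_zero oddProd := by
  have h1 : Multipliable fun i => (1 + X ^ (2 * i + 1) : ℤ⟦X⟧) :=
    multipliable_one_add_X_pow fun i => by omega
  have h2 : Multipliable fun i => (1 + X ^ (2 * (2 * i + 1)) : ℤ⟦X⟧) :=
    multipliable_one_add_X_pow fun i => by omega
  have he (k : ℕ) : (if Odd (2 * k + 1) then
      (1 + X ^ (2 * k + 1)) * (1 + X ^ (2 * (2 * k + 1))) else 1 : ℤ⟦X⟧) =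
      (1 + X ^ (2 * k + 1)) * (1 + X ^ (2 * (2 * k + 1))) := if_pos (odd_two_mul_add_one k)
  have ho (k : ℕ) : (if Odd (2 * k + 1 + 1) then
      (1 + X ^ (2 * k + 1 + 1)) * (1 + X ^ (2 * (2 * k + 1 + 1))) else 1 : ℤ⟦X⟧) = 1 :=
    if_neg (by grind)
  rw [weightSeries_threeRestricted, expand_two_oddProd, oddProd, ← h1.tprod_mul h2,
    ← tprod_even_mul_odd]
  · simp_rw [he, ho, tprod_one, mul_one]
  · simp_rw [he]
    exact h1.mul h2
  · simp_rw [ho]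
    exact multipliable_one

theorem oddPartitionMultAtMostThree_iff (m : Multiset ℕ) : OddPartitionMultAtMostThree m ↔
    (∀ i ∈ m, 0 < i ∧ Odd i) ∧ ∀ i, m.count i ≤ 3 :=
  and_congr_left' (forall₂_congr fun _ _ => ⟨fun h => ⟨h.pos, h⟩, And.right⟩)

theorem partitionMultAtMostThree_iff (m : Multiset ℕ) : PartitionMultAtMostThree m ↔
    (∀ i ∈ m, 0 < i ∧ True) ∧ ∀ i, m.count i ≤ 3 := by
  simp [PartitionMultAtMostThree]

/-- The number of pairs `(λ, μ)` with `λ` a partition into odd parts with each part size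
occurring at most three times, `μ` a partition with each part size occurring at most three
times, and `|λ| + |μ| = 2n`, equals the number of quadruples `(λ₁, λ₂, μ₁, μ₂)` of such
partitions with `|λ₁| + |λ₂| + |μ₁| + |μ₂| = n`. -/
theorem pairs_two_mul_eq_quadruples (n : ℕ) :
    Nat.card {p : Multiset ℕ × Multiset ℕ //
      OddPartitionMultAtMostThree p.1 ∧ PartitionMultAtMostThree p.2 ∧
      p.1.sum + p.2.sum = 2 * n} =
    Nat.card {q : (Fin 2 → Multiset ℕ) × (Fin 2 → Multiset ℕ) //
      (∀ k, OddPartitionMultAtMostThree (q.1 k)) ∧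
      (∀ k, PartitionMultAtMostThree (q.2 k)) ∧
      (∑ k, (q.1 k).sum) + (∑ k, (q.2 k).sum) = n} := by
  simp only [oddPartitionMultAtMostThree_iff, partitionMultAtMostThree_iff]
  let w : ThreeRestricted Odd × ThreeRestricted (fun _ => True) → ℕ :=
    fun p => p.1.1.sum + p.2.1.sum
  have hw : weightSeries w = oddProd * expand 2 two_ne_zero oddProd *
      (posProd * expand 2 two_ne_zero posProd) := by
    rw [← weightSeries_threeRestricted_odd, ← weightSeries_threeRestricted_true,
      ← weightSeries_prod (finite_threeRestricted_fiber _) (finite_threeRestricted_fiber _)]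
  have hfin : ∀ n, Finite {p // w p = n} :=
    finite_prod_weight_fiber (finite_threeRestricted_fiber _) (finite_threeRestricted_fiber _)
  have key := coeff_two_mul_eq_coeff_sq n
  rw [← hw, sq, ← weightSeries_prod hfin hfin, weightSeries, weightSeries, coeff_mk, coeff_mk,
    Nat.cast_inj] at key
  convert! key using 1
  · exact Nat.card_congr
      { toFun := fun p => ⟨(⟨p.1.1, p.2.1⟩, ⟨p.1.2, p.2.2.1⟩), p.2.2.2⟩
        invFun := fun p => ⟨(p.1.1.1, p.1.2.1), p.1.1.2, p.1.2.2, p.2⟩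
        left_inv := fun _ => rfl
        right_inv := fun _ => rfl }
  · exact Nat.card_congr
      { toFun := fun q => ⟨((⟨q.1.1 0, q.2.1 0⟩, ⟨q.1.2 0, q.2.2.1 0⟩),
          (⟨q.1.1 1, q.2.1 1⟩, ⟨q.1.2 1, q.2.2.1 1⟩)), by
            have h := q.2.2.2
            simp only [Fin.sum_univ_two] at h
            dsimp only [w]
            omega⟩
        invFun := fun p => ⟨(![p.1.1.1.1, p.1.2.1.1], ![p.1.1.2.1, p.1.2.2.1]),
          Fin.forall_fin_two.mpr ⟨p.1.1.1.2, p.1.2.1.2⟩,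
          Fin.forall_fin_two.mpr ⟨p.1.1.2.2, p.1.2.2.2⟩, by
            have h := p.2
            dsimp only [w] at h
            simp only [Fin.sum_univ_two, Matrix.cons_val_zero, Matrix.cons_val_one]
            omega⟩
        left_inv := fun q => Subtype.ext (Prod.ext (by ext1 k; fin_cases k <;> rfl)
          (by ext1 k; fin_cases k <;> rfl))
        right_inv := fun _ => rfl }
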